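/- Let x₁, …, x_n be independent random points uniformly distributed in the Euclidean unit ball B₂ⁿ and let V_{B₂ⁿ} = |conv{±x₁, …, ±x_n}| / |B₂ⁿ|. Then for every p ≥ 0, E V_{B₂ⁿ}^p = ( 2ⁿ Γ(1 + n/2) / (n! π^{n/2}) )^p · ( Γ(1 + n/2) / Γ(1 + (n+p)/2) )ⁿ · Π_{i=1}^{n} Γ((i+p)/2) / Γ(i/2). -/

import Mathlib

open MeasureTheory Pointwise

/-- The uniform probability measure on a set `K` in `ℝⁿ`. -/
noncomputable def unifMeasure (n : ℕ) (K : Set (EuclideanSpace ℝ (Fin n))) :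
    Measure (EuclideanSpace ℝ (Fin n)) :=
  (volume K)⁻¹ • volume.restrict K

/-- The joint distribution of `N` independent uniform random points in `K`. -/
noncomputable def jointUnif (n N : ℕ) (K : Set (EuclideanSpace ℝ (Fin n))) :
    Measure (Fin N → EuclideanSpace ℝ (Fin n)) :=
  Measure.pi fun _ => unifMeasure n K

/-- `V_K`: the normalized volume of the symmetric convex hull of `n` points. -/
noncomputable def randCrossVol (n : ℕ) (K : Set (EuclideanSpace ℝ (Fin n)))
    (x : Fin n → EuclideanSpace ℝ (Fin n)) : ℝ :=
  (volume (convexHull ℝ (Set.range x ∪ -Set.range x))).toReal / (volume K).toReal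

theorem lintegral_Ici_exp_neg (a : ℝ) :
    ∫⁻ u in Set.Ici a, ENNReal.ofReal (Real.exp (-u)) = ENNReal.ofReal (Real.exp (-a)) := by
  rw [setLIntegral_congr Ioi_ae_eq_Ici.symm, ← integral_exp_neg_Ioi a,
    ofReal_integral_eq_lintegral_ofReal]
  · simpa [IntegrableOn] using exp_neg_integrableOn_Ioi a one_pos
  · exact ae_of_all _ fun x => (Real.exp_pos _).le

theorem lintegral_Ioi_exp_neg_mul_rpow {s : ℝ} (hs : 0 ≤ s) :
    ∫⁻ u in Set.Ioi (0 : ℝ), ENNReal.ofReal (Real.exp (-u)) * ENNReal.ofReal (u ^ s) =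
      ENNReal.ofReal (Real.Gamma (1 + s)) := by
  have h := Real.GammaIntegral_convergent (s := 1 + s) (by linarith)
  rw [Real.Gamma_eq_integral (by linarith), ofReal_integral_eq_lintegral_ofReal h]
  · refine setLIntegral_congr_fun measurableSet_Ioi fun u _ => ?_
    simp only [add_sub_cancel_left]
    rw [ENNReal.ofReal_mul (Real.exp_pos _).le]
  · filter_upwards [ae_restrict_mem measurableSet_Ioi] with u hu
    have : (0 : ℝ) < u := hu
    positivity

section Homogeneous

variable {E : Type*} [NormedAddCommGroup E] [NormedSpace ℝ E] [FiniteDimensional ℝ E]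
  [MeasurableSpace E] [BorelSpace E] (μ : Measure E) [μ.IsAddHaarMeasure]

open Module

theorem setLIntegral_closedBall_of_homogeneous {g : E → ENNReal} {p : ℝ}
    (hg : Measurable g) (hom : ∀ t : ℝ, 0 < t → ∀ x, g (t • x) = ENNReal.ofReal (t ^ p) * g x)
    {s : ℝ} (hs : 0 < s) :
    ∫⁻ x in Metric.closedBall 0 s, g x ∂μ =
      ENNReal.ofReal (s ^ (finrank ℝ E + p)) * ∫⁻ x in Metric.closedBall 0 1, g x ∂μ := by
  have hμ : μ = ENNReal.ofReal (s ^ finrank ℝ E) • μ.map (s • ·) := by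
    rw [Measure.map_addHaar_smul μ hs.ne', smul_smul, abs_of_pos (by positivity),
      ← ENNReal.ofReal_mul (by positivity), mul_inv_cancel₀ (by positivity), ENNReal.ofReal_one,
      one_smul]
  have hpre : (s • ·) ⁻¹' Metric.closedBall (0 : E) s = Metric.closedBall 0 1 := by
    ext x
    simp [norm_smul, abs_of_pos hs, hs]
  calc
    ∫⁻ x in Metric.closedBall 0 s, g x ∂μ
        = ∫⁻ x in Metric.closedBall 0 s, g x ∂(ENNReal.ofReal (s ^ finrank ℝ E) •
            μ.map (s • ·)) := by rw [← hμ]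
    _ = ENNReal.ofReal (s ^ finrank ℝ E) * ∫⁻ x in Metric.closedBall 0 1, g (s • x) ∂μ := by
      rw [Measure.restrict_smul, lintegral_smul_measure,
        setLIntegral_map Metric.isClosed_closedBall.measurableSet hg (measurable_const_smul s),
        hpre, smul_eq_mul]
    _ = _ := by
      simp_rw [hom s hs]
      rw [lintegral_const_mul _ hg, ← mul_assoc, ← ENNReal.ofReal_mul (by positivity),
        Real.rpow_add hs, Real.rpow_natCast]

theorem lintegral_mul_exp_neg_sq_norm_of_homogeneous {g : E → ENNReal} {p : ℝ} (hp : 0 ≤ p)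
    (hg : Measurable g) (hom : ∀ t : ℝ, 0 < t → ∀ x, g (t • x) = ENNReal.ofReal (t ^ p) * g x) :
    ∫⁻ x, ENNReal.ofReal (Real.exp (-‖x‖ ^ 2)) * g x ∂μ =
      ENNReal.ofReal (Real.Gamma (1 + (finrank ℝ E + p) / 2)) *
        ∫⁻ x in Metric.closedBall 0 1, g x ∂μ := by
  have hset : MeasurableSet {z : E × ℝ | ‖z.1‖ ^ 2 ≤ z.2} :=
    measurableSet_le (by fun_prop) (by fun_prop)
  have hexp : Measurable fun u : ℝ => ENNReal.ofReal (Real.exp (-u)) := by fun_prop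
  have hmeas : Measurable fun z : E × ℝ =>
      {z : E × ℝ | ‖z.1‖ ^ 2 ≤ z.2}.indicator
        (fun z => ENNReal.ofReal (Real.exp (-z.2)) * g z.1) z :=
    Measurable.indicator (by fun_prop) hset
  calc
    ∫⁻ x, ENNReal.ofReal (Real.exp (-‖x‖ ^ 2)) * g x ∂μ
        = ∫⁻ x, (∫⁻ u in Set.Ioi (0 : ℝ), {z : E × ℝ | ‖z.1‖ ^ 2 ≤ z.2}.indicator
            (fun z => ENNReal.ofReal (Real.exp (-z.2)) * g z.1) (x, u)) ∂μ := by
      refine lintegral_congr fun x => ?_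
      have h1 : ∀ u : ℝ, {z : E × ℝ | ‖z.1‖ ^ 2 ≤ z.2}.indicator
            (fun z => ENNReal.ofReal (Real.exp (-z.2)) * g z.1) (x, u) =
          (Set.Ici (‖x‖ ^ 2)).indicator (fun u => ENNReal.ofReal (Real.exp (-u)) * g x) u :=
        fun u => rfl
      simp_rw [h1]
      rw [setLIntegral_congr Ioi_ae_eq_Ici, setLIntegral_indicator measurableSet_Ici,
        Set.inter_eq_left.2 (Set.Ici_subset_Ici.2 (by positivity)),
        lintegral_mul_const _ hexp, lintegral_Ici_exp_neg]
    _ = ∫⁻ u in Set.Ioi (0 : ℝ), ∫⁻ x, {z : E × ℝ | ‖z.1‖ ^ 2 ≤ z.2}.indicator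
            (fun z => ENNReal.ofReal (Real.exp (-z.2)) * g z.1) (x, u) ∂μ :=
      lintegral_lintegral_swap hmeas.aemeasurable
    _ = ∫⁻ u in Set.Ioi (0 : ℝ), ENNReal.ofReal (Real.exp (-u)) *
          ENNReal.ofReal (u ^ ((finrank ℝ E + p) / 2)) *
            ∫⁻ x in Metric.closedBall 0 1, g x ∂μ := by
      refine setLIntegral_congr_fun measurableSet_Ioi fun u (hu : 0 < u) => ?_
      have h1 : ∀ x : E, {z : E × ℝ | ‖z.1‖ ^ 2 ≤ z.2}.indicator
            (fun z => ENNReal.ofReal (Real.exp (-z.2)) * g z.1) (x, u) =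
          (Metric.closedBall 0 (√u)).indicator
            (fun x => ENNReal.ofReal (Real.exp (-u)) * g x) x := by
        intro x
        have : (x, u) ∈ {z : E × ℝ | ‖z.1‖ ^ 2 ≤ z.2} ↔ x ∈ Metric.closedBall (0 : E) (√u) := by
          simp only [Set.mem_ofPred_eq, mem_closedBall_zero_iff]
          rw [Real.le_sqrt (norm_nonneg x) hu.le]
        by_cases hx : x ∈ Metric.closedBall (0 : E) (√u)
        · rw [Set.indicator_of_mem (this.2 hx), Set.indicator_of_mem hx]
        · rw [Set.indicator_of_notMem (mt this.1 hx), Set.indicator_of_notMem hx]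
      simp_rw [h1]
      rw [lintegral_indicator Metric.isClosed_closedBall.measurableSet, lintegral_const_mul _ hg,
        setLIntegral_closedBall_of_homogeneous μ hg hom (Real.sqrt_pos.2 hu), mul_assoc,
        Real.sqrt_eq_rpow, ← Real.rpow_mul hu.le, one_div_mul_eq_div]
    _ = _ := by
      rw [lintegral_mul_const _ (by fun_prop), lintegral_Ioi_exp_neg_mul_rpow (by positivity)]

end Homogeneous

section Pi

variable {α : Type*} [MeasurableSpace α]

theorem measurable_fin_cons {N : ℕ} :
    Measurable fun z : α × (Fin N → α) => (Fin.cons z.1 z.2 : Fin (N + 1) → α) := by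
  refine measurable_pi_lambda _ fun i => ?_
  refine Fin.cases ?_ (fun j => ?_) i
  · simpa using measurable_fst
  · simpa [Function.comp_def] using (measurable_pi_apply j).comp measurable_snd

theorem lintegral_pi_fin_succ (μ : Measure α) [SigmaFinite μ] {N : ℕ}
    {F : (Fin (N + 1) → α) → ENNReal} (hF : Measurable F) :
    ∫⁻ x, F x ∂(Measure.pi fun _ => μ) =
      ∫⁻ a, ∫⁻ y, F (Fin.cons a y : Fin (N + 1) → α) ∂(Measure.pi fun _ => μ) ∂μ := by
  have h := (measurePreserving_piFinSuccAbove (fun _ : Fin (N + 1) => μ) 0).symm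
  have hcons : ∀ z, (MeasurableEquiv.piFinSuccAbove (fun _ : Fin (N + 1) => α) 0).symm z =
      Fin.cons z.1 z.2 := fun z => Fin.insertNth_zero' z.1 z.2
  rw [← h.lintegral_comp hF]
  simp_rw [hcons]
  exact lintegral_prod _ (hF.comp measurable_fin_cons).aemeasurable

theorem lintegral_pi_eq_pow_mul_of_update [Nonempty α] {μ ν : Measure α} [SigmaFinite μ]
    [SigmaFinite ν] {P : (α → ENNReal) → Prop} {C : ENNReal}
    (h : ∀ g, Measurable g → P g → ∫⁻ a, g a ∂μ = C * ∫⁻ a, g a ∂ν) {N : ℕ}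
    {F : (Fin N → α) → ENNReal} (hF : Measurable F)
    (hP : ∀ i x, P fun a => F (Function.update x i a)) :
    ∫⁻ x, F x ∂(Measure.pi fun _ => μ) = C ^ N * ∫⁻ x, F x ∂(Measure.pi fun _ => ν) := by
  induction N with
  | zero => rw [pow_zero, one_mul, Measure.pi_of_empty, Measure.pi_of_empty]
  | succ N ih =>
    have hcons : Measurable (Function.uncurry fun (a : α) (y : Fin N → α) =>
        F (Fin.cons a y : Fin (N + 1) → α)) := hF.comp measurable_fin_cons
    obtain ⟨w⟩ := ‹Nonempty α›
    rw [lintegral_pi_fin_succ μ hF, lintegral_pi_fin_succ ν hF,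
      lintegral_lintegral_swap hcons.aemeasurable]
    have h1 : ∀ y : Fin N → α, ∫⁻ a, F (Fin.cons a y : Fin (N + 1) → α) ∂μ =
        C * ∫⁻ a, F (Fin.cons a y : Fin (N + 1) → α) ∂ν := fun y => by
      refine h _ (hcons.comp (measurable_id.prodMk measurable_const)) ?_
      simpa using hP 0 (Fin.cons w y)
    simp_rw [h1]
    have h2 : ∀ a : α, ∫⁻ y, F (Fin.cons a y : Fin (N + 1) → α) ∂(Measure.pi fun _ => μ) =
        C ^ N * ∫⁻ y, F (Fin.cons a y : Fin (N + 1) → α) ∂(Measure.pi fun _ => ν) := fun a => by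
      refine ih (hcons.comp (measurable_const.prodMk measurable_id)) fun i y => ?_
      simpa [Fin.cons_update] using hP i.succ (Fin.cons a y)
    have hm1 : Measurable fun y : Fin N → α => ∫⁻ a, F (Fin.cons a y : Fin (N + 1) → α) ∂ν :=
      Measurable.lintegral_prod_left hcons
    have hm2 : Measurable fun a : α =>
        ∫⁻ y, F (Fin.cons a y : Fin (N + 1) → α) ∂(Measure.pi fun _ => ν) :=
      Measurable.lintegral_prod_right hcons
    rw [lintegral_const_mul _ hm1, ← lintegral_lintegral_swap hcons.aemeasurable]
    simp_rw [h2]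
    rw [lintegral_const_mul _ hm2, pow_succ', mul_assoc]

theorem lintegral_pi_comp_map {β : Type*} [MeasurableSpace β] (μ : Measure α) (ν : Measure β)
    [SigmaFinite ν] {f : α → β} (hf : Measurable f) (hμ : μ.map f = ν) {N : ℕ}
    {F : (Fin N → β) → ENNReal} (hF : Measurable F) :
    ∫⁻ x, F (fun i => f (x i)) ∂(Measure.pi fun _ => μ) = ∫⁻ y, F y ∂(Measure.pi fun _ => ν) := by
  subst hμ
  rw [← Measure.pi_map_pi (fun _ => hf.aemeasurable), lintegral_map hF (by fun_prop)]

end Pi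

/-- The centred Gaussian probability measure on `ℝⁿ` with density `π ^ (-n/2) * exp (-‖x‖ ^ 2)`. -/
noncomputable def halfGaussian (n : ℕ) : Measure (EuclideanSpace ℝ (Fin n)) :=
  (ENNReal.ofReal (√Real.pi ^ n))⁻¹ •
    volume.withDensity fun x => ENNReal.ofReal (Real.exp (-‖x‖ ^ 2))

theorem lintegral_halfGaussian (n : ℕ) {g : EuclideanSpace ℝ (Fin n) → ENNReal}
    (hg : Measurable g) :
    ∫⁻ x, g x ∂(halfGaussian n) =
      (ENNReal.ofReal (√Real.pi ^ n))⁻¹ *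
        ∫⁻ x, ENNReal.ofReal (Real.exp (-‖x‖ ^ 2)) * g x := by
  rw [halfGaussian, lintegral_smul_measure,
    lintegral_withDensity_eq_lintegral_mul _ (by fun_prop) hg, smul_eq_mul]
  rfl

theorem volume_closedBall_zero_one (n : ℕ) :
    volume (Metric.closedBall (0 : EuclideanSpace ℝ (Fin n)) 1) =
      ENNReal.ofReal (√Real.pi ^ n / Real.Gamma (1 + (n : ℝ) / 2)) := by
  rcases n.eq_zero_or_pos with rfl | hn
  · have : Metric.closedBall (0 : EuclideanSpace ℝ (Fin 0)) 1 = Set.univ :=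
      Set.eq_univ_of_forall fun x => by simp [Subsingleton.elim x 0]
    rw [this, ← (PiLp.volume_preserving_toLp (Fin 0)).measure_preimage
        MeasurableSet.univ.nullMeasurableSet,
      Set.preimage_univ, volume_pi, Measure.pi_of_empty]
    simp
  · have : Nonempty (Fin n) := ⟨⟨0, hn⟩⟩
    rw [EuclideanSpace.volume_closedBall, Fintype.card_fin, ENNReal.ofReal_one, one_pow, one_mul,
      add_comm]

theorem lintegral_unifMeasure_closedBall_of_homogeneous (n : ℕ) {p : ℝ} (hp : 0 ≤ p)
    {g : EuclideanSpace ℝ (Fin n) → ENNReal} (hg : Measurable g)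
    (hom : ∀ t : ℝ, 0 < t → ∀ x, g (t • x) = ENNReal.ofReal (t ^ p) * g x) :
    ∫⁻ x, g x ∂(unifMeasure n (Metric.closedBall 0 1)) =
      ENNReal.ofReal (Real.Gamma (1 + (n : ℝ) / 2) / Real.Gamma (1 + ((n : ℝ) + p) / 2)) *
        ∫⁻ x, g x ∂(halfGaussian n) := by
  have hG : 0 < Real.Gamma (1 + ((n : ℝ) + p) / 2) := Real.Gamma_pos_of_pos (by positivity)
  have hG' : 0 < Real.Gamma (1 + (n : ℝ) / 2) := Real.Gamma_pos_of_pos (by positivity)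
  have hpi : 0 < √Real.pi ^ n := by positivity
  rw [lintegral_halfGaussian n hg, lintegral_mul_exp_neg_sq_norm_of_homogeneous _ hp hg hom,
    finrank_euclideanSpace_fin, unifMeasure, lintegral_smul_measure, smul_eq_mul, ← mul_assoc,
    ← mul_assoc]
  congr 1
  rw [volume_closedBall_zero_one,
    ← ENNReal.ofReal_inv_of_pos (by positivity), ← ENNReal.ofReal_inv_of_pos hpi,
    ← ENNReal.ofReal_mul (by positivity), ← ENNReal.ofReal_mul (by positivity)]
  congr 1
  field_simp

theorem isProbabilityMeasure_unifMeasure_closedBall (n : ℕ) :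
    IsProbabilityMeasure (unifMeasure n (Metric.closedBall 0 1)) := by
  constructor
  rw [unifMeasure, Measure.smul_apply, Measure.restrict_apply_univ, smul_eq_mul]
  exact ENNReal.inv_mul_cancel (Metric.measure_closedBall_pos _ _ one_pos).ne'
    measure_closedBall_lt_top.ne

instance isProbabilityMeasure_halfGaussian (n : ℕ) : IsProbabilityMeasure (halfGaussian n) := by
  have := isProbabilityMeasure_unifMeasure_closedBall n
  have h := lintegral_unifMeasure_closedBall_of_homogeneous n le_rfl (g := fun _ => 1)
    measurable_const (by simp)
  have hG : Real.Gamma (1 + (n : ℝ) / 2) ≠ 0 := (Real.Gamma_pos_of_pos (by positivity)).ne'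
  constructor
  simpa [hG] using h.symm

theorem map_halfGaussian_linearIsometryEquiv (n : ℕ)
    (U : EuclideanSpace ℝ (Fin n) ≃ₗᵢ[ℝ] EuclideanSpace ℝ (Fin n)) :
    (halfGaussian n).map U = halfGaussian n := by
  refine Measure.ext_of_lintegral _ fun f hf => ?_
  have hU : Measurable U := U.continuous.measurable
  rw [lintegral_map hf hU, lintegral_halfGaussian n hf,
    lintegral_halfGaussian n (g := fun x => f (U x)) (hf.comp hU),
    ← U.measurePreserving.lintegral_comp
      (f := fun x => ENNReal.ofReal (Real.exp (-‖x‖ ^ 2)) * f x) (by fun_prop)]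
  simp

/-- Dropping the first coordinate of a point of `ℝⁿ⁺¹`. -/
noncomputable def euclideanTail {n : ℕ} (x : EuclideanSpace ℝ (Fin (n + 1))) :
    EuclideanSpace ℝ (Fin n) :=
  WithLp.toLp 2 fun j => x j.succ

theorem measurable_euclideanTail {n : ℕ} : Measurable (euclideanTail (n := n)) := by
  unfold euclideanTail
  fun_prop

theorem lintegral_exp_neg_sq :
    ∫⁻ t : ℝ, ENNReal.ofReal (Real.exp (-t ^ 2)) = ENNReal.ofReal √Real.pi := by
  have h := integral_gaussian 1
  have hi := integrable_exp_neg_mul_sq one_pos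
  simp only [neg_mul, one_mul, div_one] at h hi
  rw [← h, ofReal_integral_eq_lintegral_ofReal hi (ae_of_all _ fun t => (Real.exp_pos _).le)]

theorem map_halfGaussian_euclideanTail (n : ℕ) :
    (halfGaussian (n + 1)).map euclideanTail = halfGaussian n := by
  refine Measure.ext_of_lintegral _ fun f hf => ?_
  have hm : Measurable fun x : EuclideanSpace ℝ (Fin (n + 1)) =>
      ENNReal.ofReal (Real.exp (-‖x‖ ^ 2)) * f (euclideanTail x) :=
    Measurable.mul (by fun_prop) (hf.comp measurable_euclideanTail)
  have hm' : Measurable fun x : EuclideanSpace ℝ (Fin n) =>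
      ENNReal.ofReal (Real.exp (-‖x‖ ^ 2)) * f x := by fun_prop
  rw [lintegral_map hf measurable_euclideanTail, lintegral_halfGaussian n hf,
    lintegral_halfGaussian (n + 1) (g := fun x => f (euclideanTail x))
      (hf.comp measurable_euclideanTail),
    ← (PiLp.volume_preserving_toLp (Fin (n + 1))).lintegral_comp hm,
    ← (PiLp.volume_preserving_toLp (Fin n)).lintegral_comp hm', volume_pi, volume_pi,
    lintegral_pi_fin_succ volume (F := fun z : Fin (n + 1) → ℝ =>
      ENNReal.ofReal (Real.exp (-‖WithLp.toLp 2 z‖ ^ 2)) * f (euclideanTail (WithLp.toLp 2 z)))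
      (hm.comp (WithLp.measurable_toLp 2 _))]
  have h1 : ∀ (a : ℝ) (y : Fin n → ℝ),
      ENNReal.ofReal (Real.exp (-‖WithLp.toLp 2 (Fin.cons a y : Fin (n + 1) → ℝ)‖ ^ 2)) *
        f (euclideanTail (WithLp.toLp 2 (Fin.cons a y : Fin (n + 1) → ℝ))) =
      ENNReal.ofReal (Real.exp (-a ^ 2)) * (ENNReal.ofReal (Real.exp (-‖WithLp.toLp 2 y‖ ^ 2)) *
        f (WithLp.toLp 2 y)) := fun a y => by
    rw [← mul_assoc, ← ENNReal.ofReal_mul (Real.exp_pos _).le, ← Real.exp_add]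
    simp [EuclideanSpace.norm_sq_eq, Fin.sum_univ_succ, euclideanTail, add_comm]
  simp_rw [h1]
  have h2 := hm'.comp (WithLp.measurable_toLp 2 (Fin n → ℝ))
  simp only [Function.comp_def] at h2
  have h3 : ENNReal.ofReal √Real.pi ≠ 0 := by simp [Real.pi_pos]
  simp_rw [lintegral_const_mul _ h2]
  rw [lintegral_mul_const _ (by fun_prop), lintegral_exp_neg_sq, ← mul_assoc, pow_succ,
    ENNReal.ofReal_mul (by positivity), ENNReal.mul_inv (.inr ENNReal.ofReal_ne_top) (.inr h3),
    mul_assoc (_⁻¹) (_⁻¹), ENNReal.inv_mul_cancel h3 ENNReal.ofReal_ne_top, mul_one]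

theorem lintegral_norm_rpow_halfGaussian {n : ℕ} (hn : 0 < n) {p : ℝ} (hp : 0 ≤ p) :
    ∫⁻ x, ENNReal.ofReal (‖x‖ ^ p) ∂(halfGaussian n) =
      ENNReal.ofReal (Real.Gamma (((n : ℝ) + p) / 2) / Real.Gamma ((n : ℝ) / 2)) := by
  have : Nonempty (Fin n) := ⟨⟨0, hn⟩⟩
  have hn' : (0 : ℝ) < n := by exact_mod_cast hn
  let f : ℝ → ℝ := fun r => Real.exp (-r ^ 2) * r ^ p
  have hpow : Set.EqOn (fun y : ℝ => y ^ (n - 1) • f y)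
      (fun y => y ^ ((n : ℝ) - 1 + p) * Real.exp (-y ^ (2 : ℝ))) (Set.Ioi 0) := by
    intro y (hy : 0 < y)
    simp only [f, smul_eq_mul]
    rw [Real.rpow_add hy, ← Nat.cast_pred hn, Real.rpow_natCast, Real.rpow_two]
    ring
  have hq : -1 < (n : ℝ) - 1 + p := by linarith
  have hi : Integrable fun x : EuclideanSpace ℝ (Fin n) => f ‖x‖ := by
    rw [integrable_fun_norm_addHaar, finrank_euclideanSpace_fin,
      integrableOn_congr_fun hpow measurableSet_Ioi]
    exact integrableOn_rpow_mul_exp_neg_rpow hq two_pos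
  have hf_int : ∫ x : EuclideanSpace ℝ (Fin n), f ‖x‖ =
      √Real.pi ^ n * (Real.Gamma (((n : ℝ) + p) / 2) / Real.Gamma ((n : ℝ) / 2)) := by
    rw [integral_fun_norm_addHaar, finrank_euclideanSpace_fin,
      setIntegral_congr_fun measurableSet_Ioi hpow, integral_rpow_mul_exp_neg_rpow two_pos hq,
      measureReal_def, ← Measure.addHaar_closedBall_eq_addHaar_ball, volume_closedBall_zero_one,
      ENNReal.toReal_ofReal, add_comm 1, Real.Gamma_add_one]
    · have := Real.Gamma_pos_of_pos (half_pos hn')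
      simp only [nsmul_eq_mul, smul_eq_mul]
      rw [show (n : ℝ) - 1 + p + 1 = n + p by ring]
      field_simp
    · positivity
    · have := Real.Gamma_pos_of_pos (show 0 < 1 + (n : ℝ) / 2 by positivity)
      positivity
  have hpi : 0 < √Real.pi ^ n := by positivity
  rw [lintegral_halfGaussian n (by fun_prop)]
  have h1 : ∀ x : EuclideanSpace ℝ (Fin n), ENNReal.ofReal (Real.exp (-‖x‖ ^ 2)) *
      ENNReal.ofReal (‖x‖ ^ p) = ENNReal.ofReal (f ‖x‖) :=
    fun x => (ENNReal.ofReal_mul (Real.exp_pos _).le).symm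
  simp_rw [h1]
  rw [← ofReal_integral_eq_lintegral_ofReal hi (ae_of_all _ fun x => by positivity), hf_int,
    ← ENNReal.ofReal_inv_of_pos hpi, ← ENNReal.ofReal_mul (by positivity),
    inv_mul_cancel_left₀ hpi.ne']

/-- The matrix whose rows are the given points of `ℝⁿ`. -/
def rowMatrix {n : ℕ} (x : Fin n → EuclideanSpace ℝ (Fin n)) : Matrix (Fin n) (Fin n) ℝ :=
  Matrix.of fun i j => x i j

theorem measurable_det_rowMatrix {n : ℕ} :
    Measurable fun x : Fin n → EuclideanSpace ℝ (Fin n) => (rowMatrix x).det := by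
  simp only [Matrix.det_apply, rowMatrix, Matrix.of_apply]
  fun_prop

theorem abs_det_rowMatrix_linearIsometryEquiv {n : ℕ}
    (U : EuclideanSpace ℝ (Fin n) ≃ₗᵢ[ℝ] EuclideanSpace ℝ (Fin n))
    (x : Fin n → EuclideanSpace ℝ (Fin n)) :
    |(rowMatrix fun i => U (x i)).det| = |(rowMatrix x).det| := by
  have gram : ∀ y : Fin n → EuclideanSpace ℝ (Fin n),
      (rowMatrix y).det ^ 2 = (Matrix.of fun i j => inner ℝ (y j) (y i)).det := fun y => by
    rw [sq]
    nth_rw 2 [← Matrix.det_transpose]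
    rw [← Matrix.det_mul]
    congr 1
  rw [← sq_eq_sq_iff_abs_eq_abs, gram, gram]
  simp

theorem abs_det_rowMatrix_cons_single {n : ℕ} (r : ℝ)
    (y : Fin n → EuclideanSpace ℝ (Fin (n + 1))) :
    |(rowMatrix (Fin.cons (EuclideanSpace.single 0 r) y :
      Fin (n + 1) → EuclideanSpace ℝ (Fin (n + 1)))).det| =
      |r| * |(rowMatrix fun i => euclideanTail (y i)).det| := by
  rw [Matrix.det_succ_row_zero, Fin.sum_univ_succ]
  simp only [rowMatrix, Matrix.of_apply, Fin.cons_zero, PiLp.single_apply, Fin.succ_ne_zero]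
  simp only [if_true, if_false, mul_zero, zero_mul, Finset.sum_const_zero, add_zero, Fin.val_zero,
    pow_zero, one_mul, abs_mul]
  rfl

theorem exists_linearIsometryEquiv_apply_eq_single {n : ℕ} (x : EuclideanSpace ℝ (Fin (n + 1))) :
    ∃ U : EuclideanSpace ℝ (Fin (n + 1)) ≃ₗᵢ[ℝ] EuclideanSpace ℝ (Fin (n + 1)),
      U x = EuclideanSpace.single 0 ‖x‖ :=
  ⟨_, Submodule.reflection_sub (by simp)⟩

theorem lintegral_abs_det_rpow_halfGaussian (n : ℕ) {p : ℝ} (hp : 0 ≤ p) :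
    ∫⁻ x, ENNReal.ofReal (|(rowMatrix x).det| ^ p)
        ∂(Measure.pi fun _ : Fin n => halfGaussian n) =
      ENNReal.ofReal (∏ i ∈ Finset.Icc 1 n,
        Real.Gamma (((i : ℝ) + p) / 2) / Real.Gamma ((i : ℝ) / 2)) := by
  induction n with
  | zero => simp [rowMatrix]
  | succ n ih =>
    have hm : ∀ m, Measurable fun x : Fin m → EuclideanSpace ℝ (Fin m) =>
        ENNReal.ofReal (|(rowMatrix x).det| ^ p) := fun m => by
      have := measurable_det_rowMatrix (n := m)
      fun_prop
    have inner_eq : ∀ x : EuclideanSpace ℝ (Fin (n + 1)),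
        ∫⁻ y, ENNReal.ofReal (|(rowMatrix (Fin.cons x y : Fin (n + 1) → _)).det| ^ p)
          ∂(Measure.pi fun _ : Fin n => halfGaussian (n + 1)) =
        ENNReal.ofReal (‖x‖ ^ p) * ENNReal.ofReal (∏ i ∈ Finset.Icc 1 n,
          Real.Gamma (((i : ℝ) + p) / 2) / Real.Gamma ((i : ℝ) / 2)) := fun x => by
      obtain ⟨U, hU⟩ := exists_linearIsometryEquiv_apply_eq_single x
      have h1 : ∀ y : Fin n → EuclideanSpace ℝ (Fin (n + 1)),
          ENNReal.ofReal (|(rowMatrix (Fin.cons x y : Fin (n + 1) → _)).det| ^ p) =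
          ENNReal.ofReal (‖x‖ ^ p) *
            ENNReal.ofReal (|(rowMatrix fun i => euclideanTail (U (y i))).det| ^ p) := fun y => by
        have h2 : (fun i => U ((Fin.cons x y : Fin (n + 1) → EuclideanSpace ℝ (Fin (n + 1))) i)) =
            Fin.cons (EuclideanSpace.single 0 ‖x‖) fun i => U (y i) := by
          ext i : 1
          refine Fin.cases ?_ (fun j => ?_) i <;> simp [hU]
        rw [← abs_det_rowMatrix_linearIsometryEquiv U, h2, abs_det_rowMatrix_cons_single,
          abs_norm, Real.mul_rpow (norm_nonneg _) (abs_nonneg _),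
          ENNReal.ofReal_mul (by positivity)]
      simp_rw [h1]
      have hUm : Measurable U := U.continuous.measurable
      have htU : (halfGaussian (n + 1)).map (fun z => euclideanTail (U z)) = halfGaussian n := by
        rw [← map_halfGaussian_euclideanTail n]
        nth_rw 2 [← map_halfGaussian_linearIsometryEquiv (n + 1) U]
        rw [Measure.map_map measurable_euclideanTail hUm]
        rfl
      have htm : Measurable fun z => euclideanTail (U z) := measurable_euclideanTail.comp hUm
      have hcomp : Measurable fun y : Fin n → EuclideanSpace ℝ (Fin (n + 1)) =>
          ENNReal.ofReal (|(rowMatrix fun i => euclideanTail (U (y i))).det| ^ p) :=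
        (hm n).comp (measurable_pi_lambda _ fun i => htm.comp (measurable_pi_apply i))
      rw [lintegral_const_mul _ hcomp, lintegral_pi_comp_map _ _ htm htU (hm n), ih]
    rw [lintegral_pi_fin_succ _ (hm _)]
    simp_rw [inner_eq]
    rw [lintegral_mul_const _ (by fun_prop),
      lintegral_norm_rpow_halfGaussian n.succ_pos hp, ← ENNReal.ofReal_mul, mul_comm,
      ← Finset.prod_Icc_succ_top (by omega)
        fun i : ℕ => Real.Gamma (((i : ℝ) + p) / 2) / Real.Gamma ((i : ℝ) / 2)]
    exact div_nonneg (Real.Gamma_nonneg_of_nonneg (by positivity))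
      (Real.Gamma_nonneg_of_nonneg (by positivity))

theorem lintegral_abs_det_rpow_jointUnif (n : ℕ) {p : ℝ} (hp : 0 ≤ p) :
    ∫⁻ x, ENNReal.ofReal (|(rowMatrix x).det| ^ p) ∂(jointUnif n n (Metric.closedBall 0 1)) =
      ENNReal.ofReal ((Real.Gamma (1 + (n : ℝ) / 2) / Real.Gamma (1 + ((n : ℝ) + p) / 2)) ^ n *
        ∏ i ∈ Finset.Icc 1 n, Real.Gamma (((i : ℝ) + p) / 2) / Real.Gamma ((i : ℝ) / 2)) := by
  have := isProbabilityMeasure_unifMeasure_closedBall n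
  have hC : 0 ≤ Real.Gamma (1 + (n : ℝ) / 2) / Real.Gamma (1 + ((n : ℝ) + p) / 2) :=
    div_nonneg (Real.Gamma_nonneg_of_nonneg (by positivity))
      (Real.Gamma_nonneg_of_nonneg (by positivity))
  have hm := measurable_det_rowMatrix (n := n)
  rw [ENNReal.ofReal_mul (by positivity), ENNReal.ofReal_pow hC,
    ← lintegral_abs_det_rpow_halfGaussian n hp, jointUnif]
  refine lintegral_pi_eq_pow_mul_of_update
    (P := fun g => ∀ t : ℝ, 0 < t → ∀ x, g (t • x) = ENNReal.ofReal (t ^ p) * g x)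
    (fun g hg hom => lintegral_unifMeasure_closedBall_of_homogeneous n hp hg hom)
    (by fun_prop) fun i x t ht a => ?_
  have hrow : ∀ b : EuclideanSpace ℝ (Fin n),
      rowMatrix (Function.update x i b) = (rowMatrix x).updateRow i b := fun b => by
    ext k j
    by_cases hk : k = i
    · subst hk; simp [rowMatrix]
    · simp [rowMatrix, hk]
  have hsmul : ((t • a : EuclideanSpace ℝ (Fin n)) : Fin n → ℝ) = t • (a : Fin n → ℝ) := rfl
  simp only [hrow]
  rw [hsmul, Matrix.det_updateRow_smul, abs_mul, abs_of_pos ht,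
    Real.mul_rpow ht.le (abs_nonneg _), ENNReal.ofReal_mul (by positivity)]

theorem convexHull_range_union_neg {n : ℕ} (hn : 0 < n) {E : Type*} [AddCommGroup E] [Module ℝ E]
    (x : Fin n → E) :
    convexHull ℝ (Set.range x ∪ -Set.range x) =
      (fun c : Fin n → ℝ => ∑ i, c i • x i) '' {c | ∑ i, |c i| ≤ 1} := by
  refine Set.Subset.antisymm (convexHull_min ?_ ?_) ?_
  · rintro y (⟨i, rfl⟩ | ⟨i, hi⟩)
    · refine ⟨Pi.single i 1, ?_, ?_⟩
      · simp [Pi.single_apply, apply_ite abs]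
      · simp [Pi.single_apply, ite_smul]
    · refine ⟨Pi.single i (-1), ?_, ?_⟩
      · simp [Pi.single_apply, apply_ite abs]
      · simp [Pi.single_apply, ite_smul, hi]
  · rintro _ ⟨c, hc, rfl⟩ _ ⟨d, hd, rfl⟩ a b ha hb hab
    refine ⟨a • c + b • d, ?_, ?_⟩
    · calc ∑ i, |(a • c + b • d) i| ≤ ∑ i, (a * |c i| + b * |d i|) := by
            refine Finset.sum_le_sum fun i _ => (abs_add_le _ _).trans ?_
            simp [abs_mul, abs_of_nonneg ha, abs_of_nonneg hb]
        _ = a * ∑ i, |c i| + b * ∑ i, |d i| := by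
            rw [Finset.sum_add_distrib, Finset.mul_sum, Finset.mul_sum]
        _ ≤ a * 1 + b * 1 := by gcongr <;> assumption
        _ = 1 := by rw [mul_one, mul_one, hab]
    · simp [add_smul, mul_smul, Finset.sum_add_distrib, Finset.smul_sum]
  · rintro _ ⟨c, hc, rfl⟩
    set H := convexHull ℝ (Set.range x ∪ -Set.range x)
    have hH : Convex ℝ H := convex_convexHull _ _
    have hpos : ∀ i, x i ∈ H := fun i => subset_convexHull _ _ (.inl ⟨i, rfl⟩)
    have hneg : ∀ i, -x i ∈ H := fun i => subset_convexHull _ _ (.inr ⟨i, by simp⟩)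
    have hzero : (0 : E) ∈ H := by
      have := hH (hpos ⟨0, hn⟩) (hneg ⟨0, hn⟩) (a := 1 / 2) (b := 1 / 2) (by norm_num)
        (by norm_num) (by norm_num)
      simpa using this
    let w : Option (Fin n) → ℝ := fun o => o.elim (1 - ∑ i, |c i|) fun i => |c i|
    let z : Option (Fin n) → E := fun o => o.elim 0 fun i => if 0 ≤ c i then x i else -x i
    have hsum : ∑ o, w o • z o ∈ H := by
      refine hH.sum_mem (fun o _ => ?_) ?_ fun o _ => ?_
      · cases o
        · exact sub_nonneg.2 hc
        · exact abs_nonneg _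
      · simp [w, Fintype.sum_option]
      · cases o with
        | none => exact hzero
        | some i =>
          by_cases h : 0 ≤ c i
          · simpa [z, h] using hpos i
          · simpa [z, h] using hneg i
    convert hsum using 1
    simp only [w, z, Fintype.sum_option, Option.elim_none, Option.elim_some, smul_zero, zero_add]
    refine Finset.sum_congr rfl fun i _ => ?_
    split_ifs with h
    · rw [abs_of_nonneg h]
    · rw [abs_of_neg (not_le.1 h), smul_neg, neg_smul, neg_neg]

theorem volume_sum_abs_le_one {n : ℕ} (hn : 0 < n) :
    volume {c : EuclideanSpace ℝ (Fin n) | ∑ i, |c i| ≤ 1} =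
      ENNReal.ofReal (2 ^ n / n.factorial) := by
  have : Nonempty (Fin n) := ⟨⟨0, hn⟩⟩
  have h := volume_sum_rpow_le (Fin n) le_rfl 1
  have hG : Real.Gamma 2 = 1 := by simp
  simp only [Real.rpow_one, div_one, Fintype.card_fin, ENNReal.ofReal_one, one_pow, one_mul,
    one_add_one_eq_two, hG, mul_one, Real.Gamma_nat_eq_factorial] at h
  have hs : MeasurableSet {c : EuclideanSpace ℝ (Fin n) | ∑ i, |c i| ≤ 1} :=
    measurableSet_le (by fun_prop) (by fun_prop)
  rw [← h, ← (PiLp.volume_preserving_toLp (Fin n)).measure_preimage hs.nullMeasurableSet]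
  rfl

theorem volume_convexHull_range_union_neg {n : ℕ} (hn : 0 < n)
    (x : Fin n → EuclideanSpace ℝ (Fin n)) :
    volume (convexHull ℝ (Set.range x ∪ -Set.range x)) =
      ENNReal.ofReal (|(rowMatrix x).det| * (2 ^ n / n.factorial)) := by
  have himage : (fun c : Fin n → ℝ => ∑ i, c i • x i) '' {c | ∑ i, |c i| ≤ 1} =
      Matrix.toEuclideanLin (rowMatrix x).transpose ''
        {c : EuclideanSpace ℝ (Fin n) | ∑ i, |c i| ≤ 1} := by
    have happly : ∀ c : EuclideanSpace ℝ (Fin n),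
        Matrix.toEuclideanLin (rowMatrix x).transpose c = ∑ i, c i • x i := fun c => by
      ext j
      simp [rowMatrix, Matrix.mulVec, dotProduct, mul_comm]
    ext y
    constructor
    · rintro ⟨c, hc, rfl⟩
      exact ⟨WithLp.toLp 2 c, hc, happly _⟩
    · rintro ⟨c, hc, rfl⟩
      exact ⟨c, hc, (happly c).symm⟩
  rw [convexHull_range_union_neg hn, himage, Measure.addHaar_image_linearMap,
    volume_sum_abs_le_one hn, ← ENNReal.ofReal_mul (abs_nonneg _),
    Matrix.toEuclideanLin_eq_toLin_orthonormal, LinearMap.det_toLin, Matrix.det_transpose]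

theorem randCrossVol_closedBall {n : ℕ} (hn : 0 < n) (x : Fin n → EuclideanSpace ℝ (Fin n)) :
    randCrossVol n (Metric.closedBall 0 1) x =
      (2 ^ n : ℝ) * Real.Gamma (1 + (n : ℝ) / 2) /
        ((n.factorial : ℝ) * Real.pi ^ ((n : ℝ) / 2)) * |(rowMatrix x).det| := by
  have hG : 0 < Real.Gamma (1 + (n : ℝ) / 2) := Real.Gamma_pos_of_pos (by positivity)
  have hpi : Real.pi ^ ((n : ℝ) / 2) = √Real.pi ^ n := by
    rw [Real.sqrt_eq_rpow, ← Real.rpow_natCast, ← Real.rpow_mul Real.pi_nonneg]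
    ring_nf
  rw [randCrossVol, volume_convexHull_range_union_neg hn, volume_closedBall_zero_one,
    ENNReal.toReal_ofReal (by positivity), ENNReal.toReal_ofReal (by positivity), hpi]
  field_simp

/-- All moments of the normalized volume of a random crosspolytope in the Euclidean ball:
`𝔼 V_{B₂ⁿ}^p = (2ⁿ Γ(1+n/2)/(n! π^{n/2}))^p (Γ(1+n/2)/Γ(1+(n+p)/2))ⁿ
· Π_{i=1}^{n} Γ((i+p)/2)/Γ(i/2)`. -/
theorem moments_randCrossVol_ball
    (n : ℕ) (hn : 0 < n) (p : ℝ) (hp : 0 ≤ p) :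
    ∫ x, randCrossVol n (Metric.closedBall (0 : EuclideanSpace ℝ (Fin n)) 1) x ^ p
        ∂(jointUnif n n (Metric.closedBall (0 : EuclideanSpace ℝ (Fin n)) 1)) =
      ((2 ^ n : ℝ) * Real.Gamma (1 + (n : ℝ) / 2) /
          ((n.factorial : ℝ) * Real.pi ^ ((n : ℝ) / 2))) ^ p *
        (Real.Gamma (1 + (n : ℝ) / 2) / Real.Gamma (1 + ((n : ℝ) + p) / 2)) ^ n *
        ∏ i ∈ Finset.Icc 1 n,
          Real.Gamma (((i : ℝ) + p) / 2) / Real.Gamma ((i : ℝ) / 2) := by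
  have hG : 0 < Real.Gamma (1 + (n : ℝ) / 2) := Real.Gamma_pos_of_pos (by positivity)
  have hG' : 0 < Real.Gamma (1 + ((n : ℝ) + p) / 2) := Real.Gamma_pos_of_pos (by positivity)
  have hprod : 0 ≤ ∏ i ∈ Finset.Icc 1 n,
      Real.Gamma (((i : ℝ) + p) / 2) / Real.Gamma ((i : ℝ) / 2) :=
    Finset.prod_nonneg fun i _ => div_nonneg (Real.Gamma_nonneg_of_nonneg (by positivity))
      (Real.Gamma_nonneg_of_nonneg (by positivity))
  have hm := measurable_det_rowMatrix (n := n)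
  have hmp : Measurable fun x : Fin n → EuclideanSpace ℝ (Fin n) => |(rowMatrix x).det| ^ p := by
    fun_prop
  simp_rw [randCrossVol_closedBall hn]
  have hsplit : ∀ x : Fin n → EuclideanSpace ℝ (Fin n),
      ((2 ^ n : ℝ) * Real.Gamma (1 + (n : ℝ) / 2) /
        ((n.factorial : ℝ) * Real.pi ^ ((n : ℝ) / 2)) * |(rowMatrix x).det|) ^ p =
      ((2 ^ n : ℝ) * Real.Gamma (1 + (n : ℝ) / 2) /
        ((n.factorial : ℝ) * Real.pi ^ ((n : ℝ) / 2))) ^ p * |(rowMatrix x).det| ^ p :=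
    fun x => Real.mul_rpow (by positivity) (abs_nonneg _)
  simp_rw [hsplit]
  rw [integral_const_mul, mul_assoc, integral_eq_lintegral_of_nonneg_ae
      (ae_of_all _ fun x => by positivity) hmp.aestronglyMeasurable,
    lintegral_abs_det_rpow_jointUnif n hp, ENNReal.toReal_ofReal (by positivity)]
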